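/- arXiv:2303.17030 — 2 statements merged into one kernel-verified Lean document; each statement's English description precedes it below -/
import Mathlib

section
/- The function Φ is strictly increasing on (−1/2, ∞), satisfies Φ(0) = 0, Φ(q) → −∞ as q → (−1/2)⁺, and Φ(q) → +∞ as q → +∞. -/
open MeasureTheory Real

/-- The density of the Lévy measure `Λ` of the subordinator in the Lamperti
representation of the tagged fragment of the Brownian excursion fragmentation:
`ρ(x) = 2·exp(x)/√(2π·(exp(x) − 1)³)`. -/
noncomputable def levyDensity (x : ℝ) : ℝ :=
  2 * Real.exp x / Real.sqrt (2 * Real.pi * (Real.exp x - 1) ^ 3)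

/-- The Laplace exponent `Φ(q) = ∫₀^∞ (1 − exp(−q·x))·ρ(x) dx`. -/
noncomputable def Phi (q : ℝ) : ℝ :=
  ∫ x in Set.Ioi (0:ℝ), (1 - Real.exp (-q * x)) * levyDensity x

lemma levyDensity_pos {x : ℝ} (hx : 0 < x) : 0 < levyDensity x := by
  have h : 0 < Real.exp x - 1 := by linarith [Real.add_one_lt_exp hx.ne']
  unfold levyDensity
  positivity

lemma measurable_levyDensity : Measurable levyDensity := by
  unfold levyDensity
  fun_prop

lemma sqrt_pow_three {x : ℝ} (hx : 0 ≤ x) : √(x ^ 3) = x * √x := by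
  rw [show x ^ 3 = x ^ 2 * x by ring, Real.sqrt_mul (sq_nonneg x), Real.sqrt_sq hx]

lemma levyDensity_le_near_zero {x : ℝ} (hx : 0 < x) :
    levyDensity x ≤ 2 * Real.exp x / (x * √x) := by
  have h : x ≤ Real.exp x - 1 := by linarith [Real.add_one_le_exp x]
  have hp : x ^ 3 ≤ (Real.exp x - 1) ^ 3 := by gcongr
  rw [← sqrt_pow_three hx.le]
  unfold levyDensity
  gcongr
  nlinarith [Real.pi_gt_three, pow_pos hx 3]

lemma le_levyDensity_near_zero {x : ℝ} (hx : 0 < x) (hx1 : x ≤ 1) :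
    1 / (4 * (x * √x)) ≤ levyDensity x := by
  have h : 0 < Real.exp x - 1 := by linarith [Real.add_one_lt_exp hx.ne']
  have h2 : Real.exp x - 1 ≤ 2 * x := by
    have := Real.abs_exp_sub_one_le (x := x) (by rwa [abs_of_pos hx])
    rwa [abs_of_pos h, abs_of_pos hx] at this
  have hp : (Real.exp x - 1) ^ 3 ≤ (2 * x) ^ 3 := by gcongr
  have hs : √(2 * π * (Real.exp x - 1) ^ 3) ≤ 8 * (x * √x) := by
    rw [← sqrt_pow_three hx.le]
    apply Real.sqrt_le_iff.2 ⟨by positivity, ?_⟩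
    rw [mul_pow, Real.sq_sqrt (by positivity)]
    nlinarith [Real.pi_lt_four, Real.pi_pos, pow_pos hx 3, pow_pos h 3]
  calc 1 / (4 * (x * √x)) = 2 * 1 / (8 * (x * √x)) := by field_simp; norm_num
    _ ≤ 2 * Real.exp x / √(2 * π * (Real.exp x - 1) ^ 3) := by
      gcongr
      linarith

lemma sqrt_exp_pow_three (x : ℝ) :
    √(Real.exp x ^ 3) = Real.exp x * Real.exp (x / 2) := by
  rw [sqrt_pow_three (Real.exp_pos x).le, Real.exp_half]

lemma half_exp_le_levyDensity {x : ℝ} (hx : 0 < x) :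
    1 / 2 * Real.exp (-x / 2) ≤ levyDensity x := by
  have h : 0 < Real.exp x - 1 := by linarith [Real.add_one_lt_exp hx.ne']
  have hp : (Real.exp x - 1) ^ 3 ≤ Real.exp x ^ 3 := by gcongr; linarith
  have hs : √(2 * π * (Real.exp x - 1) ^ 3) ≤ 4 * (Real.exp x * Real.exp (x / 2)) := by
    rw [← sqrt_exp_pow_three]
    apply Real.sqrt_le_iff.2 ⟨by positivity, ?_⟩
    rw [mul_pow, Real.sq_sqrt (by positivity)]
    nlinarith [Real.pi_lt_four, Real.pi_pos, pow_pos h 3]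
  calc 1 / 2 * Real.exp (-x / 2) = 2 * Real.exp x / (4 * (Real.exp x * Real.exp (x / 2))) := by
        rw [neg_div, Real.exp_neg]; field_simp; norm_num
    _ ≤ levyDensity x := by unfold levyDensity; gcongr

lemma levyDensity_le_of_one_le {x : ℝ} (hx : 1 ≤ x) :
    levyDensity x ≤ 4 * Real.exp (-x / 2) := by
  have h : Real.exp x / 2 ≤ Real.exp x - 1 := by linarith [Real.add_one_le_exp x]
  have hp : (Real.exp x / 2) ^ 3 ≤ (Real.exp x - 1) ^ 3 := by gcongr
  have hs : 1 / 2 * (Real.exp x * Real.exp (x / 2)) ≤ √(2 * π * (Real.exp x - 1) ^ 3) := by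
    rw [← sqrt_exp_pow_three]
    apply Real.le_sqrt_of_sq_le
    rw [mul_pow, Real.sq_sqrt (by positivity)]
    nlinarith [Real.pi_gt_three, pow_pos (Real.exp_pos x) 3]
  calc levyDensity x ≤ 2 * Real.exp x / (1 / 2 * (Real.exp x * Real.exp (x / 2))) := by
        unfold levyDensity; gcongr
    _ = 4 * Real.exp (-x / 2) := by
        rw [neg_div, Real.exp_neg]; field_simp; norm_num

lemma abs_one_sub_exp_neg_le (y : ℝ) : |1 - Real.exp (-y)| ≤ |y| * Real.exp |y| := by
  have h1 := Real.add_one_le_exp (-y)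
  have h3 : 1 ≤ Real.exp |y| := Real.one_le_exp (abs_nonneg y)
  rcases le_total 0 y with hy | hy
  · have h2 : Real.exp (-y) ≤ 1 := Real.exp_le_one_iff.2 (by linarith)
    rw [abs_of_nonneg (by linarith : (0:ℝ) ≤ 1 - Real.exp (-y))]
    nlinarith [abs_of_nonneg hy]
  · rw [abs_of_nonpos hy, abs_of_nonpos (by linarith : 1 - Real.exp (-y) ≤ 0)]
    have h2 := Real.add_one_le_exp y
    have h4 : Real.exp (-y) * Real.exp y = 1 := by rw [← Real.exp_add]; simp
    nlinarith [Real.exp_pos (-y)]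

lemma integrableOn_phi {q : ℝ} (hq : -(1/2) < q) :
    IntegrableOn (fun x => (1 - Real.exp (-q * x)) * levyDensity x) (Set.Ioi 0) := by
  have hm : Measurable (fun x => (1 - Real.exp (-q * x)) * levyDensity x) :=
    (by fun_prop : Measurable fun x => 1 - Real.exp (-q * x)).mul measurable_levyDensity
  rw [← Set.Ioc_union_Ioi_eq_Ioi (zero_le_one (α := ℝ))]
  refine IntegrableOn.union ?_ ?_
  · have hi : IntegrableOn
        (fun x : ℝ => |q| * Real.exp |q| * (2 * Real.exp 1) * x ^ (-(1/2) : ℝ)) (Set.Ioc 0 1) :=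
      ((intervalIntegrable_iff_integrableOn_Ioc_of_le zero_le_one).1
        (intervalIntegral.intervalIntegrable_rpow' (by norm_num))).const_mul _
    refine hi.mono' hm.aestronglyMeasurable
      ((ae_restrict_iff' measurableSet_Ioc).2 (.of_forall fun x ⟨hx, hx1⟩ => ?_))
    have hρ := levyDensity_pos hx
    have h1 : |1 - Real.exp (-q * x)| ≤ |q| * x * Real.exp |q| := by
      have := abs_one_sub_exp_neg_le (q * x)
      rw [abs_mul, abs_of_pos hx, ← neg_mul] at this
      refine this.trans ?_
      gcongr
      nlinarith [abs_nonneg q]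
    have h2 : levyDensity x ≤ 2 * Real.exp 1 / (x * √x) :=
      (levyDensity_le_near_zero hx).trans (by gcongr)
    rw [Real.norm_eq_abs, abs_mul, abs_of_pos hρ]
    calc _ ≤ |q| * x * Real.exp |q| * (2 * Real.exp 1 / (x * √x)) := by gcongr
      _ = _ := by
        rw [Real.rpow_neg hx.le, ← Real.sqrt_eq_rpow]
        field_simp
  · have hi : IntegrableOn (fun x : ℝ => 4 * Real.exp (-(1/2) * x)
        + 4 * Real.exp (-(q + 1/2) * x)) (Set.Ioi 1) :=
      ((exp_neg_integrableOn_Ioi 1 (by norm_num)).const_mul 4).add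
        ((exp_neg_integrableOn_Ioi 1 (by linarith)).const_mul 4)
    refine hi.mono' hm.aestronglyMeasurable
      ((ae_restrict_iff' measurableSet_Ioi).2 (.of_forall fun x hx => ?_))
    have hx : 1 < x := hx
    have hρ := levyDensity_pos (zero_lt_one.trans hx)
    have h1 : |1 - Real.exp (-q * x)| ≤ 1 + Real.exp (-q * x) := by
      have := Real.exp_pos (-q * x)
      rw [abs_le]; constructor <;> linarith
    rw [Real.norm_eq_abs, abs_mul, abs_of_pos hρ]
    calc _ ≤ (1 + Real.exp (-q * x)) * (4 * Real.exp (-x / 2)) := by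
          gcongr; exact levyDensity_le_of_one_le hx.le
      _ = 4 * Real.exp (-x / 2) + 4 * (Real.exp (-q * x) * Real.exp (-x / 2)) := by ring
      _ = _ := by
        rw [← Real.exp_add]; ring_nf

lemma strictMonoOn_Phi : StrictMonoOn Phi (Set.Ioi (-(1/2) : ℝ)) := by
  intro p hp q hq hpq
  have hip := integrableOn_phi hp
  have hiq := integrableOn_phi hq
  have hpos : ∀ x ∈ Set.Ioi (0:ℝ), 0 < (1 - Real.exp (-q * x)) * levyDensity x
      - (1 - Real.exp (-p * x)) * levyDensity x := by
    intro x (hx : 0 < x)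
    have h : Real.exp (-q * x) < Real.exp (-p * x) := Real.exp_lt_exp.2 (by nlinarith)
    nlinarith [levyDensity_pos hx]
  rw [← sub_pos]
  unfold Phi
  rw [← integral_sub hiq hip, setIntegral_pos_iff_support_of_nonneg_ae
    ((ae_restrict_iff' measurableSet_Ioi).2 (.of_forall fun x hx => (hpos x hx).le))
    (hiq.sub hip),
    Set.inter_eq_right.2 fun x hx => Function.mem_support.2 (hpos x hx).ne']
  simp

lemma Phi_zero : Phi 0 = 0 := by simp [Phi]

lemma Phi_le_of_nonpos {q : ℝ} (hq : -(1/2) < q) (hq0 : q ≤ 0) :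
    Phi q ≤ 1 - 1 / 2 * (q + 1 / 2)⁻¹ := by
  have hi1 : IntegrableOn (fun x : ℝ => Real.exp (-(1/2) * x)) (Set.Ioi 0) :=
    exp_neg_integrableOn_Ioi 0 (by norm_num)
  have hi2 : IntegrableOn (fun x : ℝ => Real.exp (-(q + 1/2) * x)) (Set.Ioi 0) :=
    exp_neg_integrableOn_Ioi 0 (by linarith)
  have h : ∫ x in Set.Ioi (0:ℝ), (1 / 2 * Real.exp (-(1/2) * x)
      - 1 / 2 * Real.exp (-(q + 1/2) * x)) = 1 - 1 / 2 * (q + 1 / 2)⁻¹ := by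
    rw [integral_sub (hi1.const_mul _) (hi2.const_mul _), integral_const_mul, integral_const_mul,
      integral_exp_mul_Ioi (by norm_num), integral_exp_mul_Ioi (by linarith)]
    simp only [mul_zero, Real.exp_zero, neg_div_neg_eq, one_div]
    norm_num
  rw [← h]
  refine setIntegral_mono_on (integrableOn_phi hq) ((hi1.const_mul _).sub (hi2.const_mul _))
    measurableSet_Ioi fun x (hx : 0 < x) => ?_
  have h1 : 1 ≤ Real.exp (-q * x) := Real.one_le_exp (by nlinarith)
  have h2 : Real.exp (-(q + 1/2) * x) = Real.exp (-q * x) * Real.exp (-x / 2) := by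
    rw [← Real.exp_add]; ring_nf
  have h3 : -(1/2) * x = -x / 2 := by ring
  rw [h2, h3]
  nlinarith [half_exp_le_levyDensity hx]

lemma le_Phi_of_two_le {q : ℝ} (hq : 2 ≤ q) : √(q / 2) / 16 ≤ Phi q := by
  have hq0 : 0 < q := by linarith
  have hi := integrableOn_phi (q := q) (by linarith)
  have hsub : Set.Ioc (1 / q) (2 / q) ⊆ Set.Ioi 0 := fun x hx =>
    lt_trans (by positivity : 0 < 1 / q) hx.1
  have hmono : ∫ x in Set.Ioc (1 / q) (2 / q), (1 - Real.exp (-q * x)) * levyDensity x ≤ Phi q := by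
    refine setIntegral_mono_set hi
      ((ae_restrict_iff' measurableSet_Ioi).2 (.of_forall fun x (hx : 0 < x) => ?_))
      hsub.eventuallyLE
    have h1 : Real.exp (-q * x) ≤ 1 := Real.exp_le_one_iff.2 (by nlinarith)
    exact mul_nonneg (by linarith) (levyDensity_pos hx).le
  refine le_trans ?_ hmono
  have hc : ∫ _ in Set.Ioc (1 / q) (2 / q), (1 / 2 * (1 / (4 * (2 / q * √(2 / q)))) : ℝ)
      = √(q / 2) / 16 := by
    rw [setIntegral_const, measureReal_def, Real.volume_Ioc,
      ENNReal.toReal_ofReal (by rw [← sub_div]; norm_num; exact hq0.le),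
      show 2 / q = (q / 2)⁻¹ by rw [inv_div], Real.sqrt_inv, inv_div, smul_eq_mul]
    field_simp
    norm_num
  rw [← hc]
  refine setIntegral_mono_on (integrableOn_const (by simp)) (hi.mono_set hsub)
    measurableSet_Ioc fun x hx => ?_
  have hx0 : 0 < x := hsub hx
  have hx1 : x ≤ 1 := hx.2.trans ((div_le_one hq0).2 hq)
  have h1 : Real.exp (-q * x) ≤ 1 / 2 := by
    have h : 1 ≤ q * x := by
      have := (div_lt_iff₀' hq0).1 hx.1
      exact this.le
    have h2 : 2 ≤ Real.exp (q * x) := by linarith [Real.add_one_le_exp (q * x)]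
    rw [neg_mul, Real.exp_neg, one_div]
    gcongr
  have h2 : 1 / (4 * (2 / q * √(2 / q))) ≤ levyDensity x := by
    refine le_trans ?_ (le_levyDensity_near_zero hx0 hx1)
    have := hx.2
    gcongr
  have h3 : (0:ℝ) ≤ 1 / (4 * (2 / q * √(2 / q))) := by positivity
  exact mul_le_mul (by linarith) h2 h3 (by linarith)

lemma tendsto_Phi_nhdsWithin :
    Filter.Tendsto Phi (nhdsWithin (-(1/2) : ℝ) (Set.Ioi (-(1/2) : ℝ))) Filter.atBot := by
  have h0 : Filter.Tendsto (fun q : ℝ => q + 1 / 2)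
      (nhdsWithin (-(1/2) : ℝ) (Set.Ioi (-(1/2) : ℝ))) (nhdsWithin 0 (Set.Ioi 0)) := by
    refine tendsto_nhdsWithin_iff.2 ⟨?_, ?_⟩
    · refine Filter.Tendsto.mono_left ?_ nhdsWithin_le_nhds
      exact Continuous.tendsto' (by fun_prop) _ _ (by norm_num)
    · filter_upwards [self_mem_nhdsWithin] with q (hq : -(1/2) < q)
      exact (by linarith : 0 < q + 1 / 2)
  have h1 : Filter.Tendsto (fun q : ℝ => 1 - 1 / 2 * (q + 1 / 2)⁻¹)
      (nhdsWithin (-(1/2) : ℝ) (Set.Ioi (-(1/2) : ℝ))) Filter.atBot := by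
    simp only [sub_eq_add_neg]
    exact Filter.tendsto_atBot_add_const_left _ _ (Filter.tendsto_neg_atTop_atBot.comp
      ((tendsto_inv_nhdsGT_zero.comp h0).const_mul_atTop (by norm_num)))
  refine Filter.tendsto_atBot_mono' _ ?_ h1
  filter_upwards [self_mem_nhdsWithin,
    mem_nhdsWithin_of_mem_nhds (Iio_mem_nhds (by norm_num : -(1/2) < (0:ℝ)))] with q hq hq0
  exact Phi_le_of_nonpos hq (le_of_lt hq0)

lemma tendsto_Phi_atTop : Filter.Tendsto Phi Filter.atTop Filter.atTop := by
  have h : Filter.Tendsto (fun q : ℝ => √(q / 2) / 16) Filter.atTop Filter.atTop :=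
    (Real.tendsto_sqrt_atTop.comp (Filter.tendsto_id.atTop_div_const (by norm_num))).atTop_div_const
      (by norm_num)
  refine Filter.tendsto_atTop_mono' _ ?_ h
  filter_upwards [Filter.eventually_ge_atTop 2] with q hq
  exact le_Phi_of_two_le hq

theorem stmt_2 :
    StrictMonoOn Phi (Set.Ioi (-(1/2) : ℝ)) ∧
    Phi 0 = 0 ∧
    Filter.Tendsto Phi (nhdsWithin (-(1/2) : ℝ) (Set.Ioi (-(1/2) : ℝ))) Filter.atBot ∧
    Filter.Tendsto Phi Filter.atTop Filter.atTop :=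
  ⟨strictMonoOn_Phi, Phi_zero, tendsto_Phi_nhdsWithin, tendsto_Phi_atTop⟩
end

section
/- The map p ↦ λ_*(p) is strictly decreasing on (0,1); equivalently, the map p ↦ α_*(p) := 1 − λ_*(p) is strictly increasing on (0,1). -/
open MeasureTheory Real

/-- The Laplace exponent
`Φ^S_p(q) = ∫₀^∞ (1 − exp(−q·x))·(1_{(0, log 2]}(x) + p·1_{(log 2, ∞)}(x))·ρ(x) dx`. -/
noncomputable def PhiS (p q : ℝ) : ℝ :=
  ∫ x in Set.Ioi (0:ℝ), (1 - Real.exp (-q * x)) *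
    ((Set.Ioc (0:ℝ) (Real.log 2)).indicator (fun _ => (1:ℝ)) x
      + p * (Set.Ioi (Real.log 2)).indicator (fun _ => (1:ℝ)) x) * levyDensity x


lemma levyDensity_nonneg (x : ℝ) : 0 ≤ levyDensity x := by
  unfold levyDensity
  positivity

/-- If the integral defining `PhiS p₂ (-l₂)` converges to a nonzero value, then `-PhiS p (-l)` is
monotone in `p` and `l` up to `(p₂, l₂)`; convergence at `(p₂, l₂)` follows from `PhiS ≠ 0`. -/
lemma PhiS_neg_le_of_le {p₁ p₂ l₁ l₂ : ℝ} (hp₁ : 0 ≤ p₁) (hp : p₁ ≤ p₂) (hl₁ : 0 ≤ l₁)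
    (hl : l₁ ≤ l₂) (h_ne : PhiS p₂ (-l₂) ≠ 0) : PhiS p₂ (-l₂) ≤ PhiS p₁ (-l₁) := by
  have h_int := not_imp_comm.1 integral_undef h_ne
  unfold PhiS
  rw [← neg_le_neg_iff, ← integral_neg, ← integral_neg]
  have h_weight : ∀ p : ℝ, 0 ≤ p → ∀ x : ℝ,
      0 ≤ (Set.Ioc (0:ℝ) (Real.log 2)).indicator (fun _ => (1:ℝ)) x
        + p * (Set.Ioi (Real.log 2)).indicator (fun _ => (1:ℝ)) x := fun p h x =>
    add_nonneg (Set.indicator_nonneg (fun _ _ => zero_le_one) x)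
      (mul_nonneg h (Set.indicator_nonneg (fun _ _ => zero_le_one) x))
  have h_exp : ∀ x : ℝ, 0 < x → 0 ≤ Real.exp (l₁ * x) - 1 := fun x hx =>
    sub_nonneg.2 (Real.one_le_exp (by positivity))
  refine integral_mono_of_nonneg ?_ h_int.neg ?_ <;>
    filter_upwards [ae_restrict_mem measurableSet_Ioi] with x hx
  · have h := mul_nonneg (mul_nonneg (h_exp x hx) (h_weight p₁ hp₁ x)) (levyDensity_nonneg x)
    simp only [Pi.zero_apply, neg_neg]
    linarith
  · have h_exp_le : Real.exp (l₁ * x) - 1 ≤ Real.exp (l₂ * x) - 1 := by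
      have : l₁ * x ≤ l₂ * x := mul_le_mul_of_nonneg_right hl (le_of_lt hx)
      gcongr
    have h_weight_le := add_le_add_right (mul_le_mul_of_nonneg_right hp
      (Set.indicator_nonneg (s := Set.Ioi (Real.log 2)) (f := fun _ => (1:ℝ))
        (fun _ _ => zero_le_one) x))
      ((Set.Ioc (0:ℝ) (Real.log 2)).indicator (fun _ => (1:ℝ)) x)
    have h := mul_le_mul_of_nonneg_right
      (mul_le_mul h_exp_le h_weight_le (h_weight p₁ hp₁ x) ((h_exp x hx).trans h_exp_le))
      (levyDensity_nonneg x)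
    simp only [neg_neg]
    linarith

theorem stmt_9 (lam : ℝ → ℝ)
    (hlam : ∀ p ∈ Set.Ioo (0:ℝ) 1, lam p ∈ Set.Ioo (0:ℝ) (1/2) ∧
      PhiS p (-(lam p)) = -(2 * (1 - p) * Real.sqrt (2 / Real.pi))) :
    StrictAntiOn lam (Set.Ioo (0:ℝ) 1) ∧
    StrictMonoOn (fun p => 1 - lam p) (Set.Ioo (0:ℝ) 1) := by
  have h_anti : StrictAntiOn lam (Set.Ioo (0:ℝ) 1) := by
    intro p₁ hp₁ p₂ hp₂ hlt
    by_contra! hle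
    have h_sqrt : 0 < Real.sqrt (2 / Real.pi) := by positivity
    have h_pos : 0 < (1 - p₂) * Real.sqrt (2 / Real.pi) :=
      mul_pos (sub_pos.2 hp₂.2) h_sqrt
    have h := PhiS_neg_le_of_le hp₁.1.le hlt.le (hlam p₁ hp₁).1.1.le hle
      (by rw [(hlam p₂ hp₂).2]; linarith)
    rw [(hlam p₁ hp₁).2, (hlam p₂ hp₂).2] at h
    nlinarith
  exact ⟨h_anti, fun p₁ hp₁ p₂ hp₂ hlt => sub_lt_sub_left (h_anti hp₁ hp₂ hlt) 1⟩
end
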